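/- If x is a standard p-dimensional Gaussian vector and Q, R, S are p×p real matrices, then E[(x'Qx)(x'Rx)(x'Sx)] = tr(Q)tr(R)tr(S) + tr(Q)tr(RS) + tr(Q)tr(RSᵀ) + tr(R)tr(QS) + tr(R)tr(QSᵀ) + tr(S)tr(QR) + tr(S)tr(QRᵀ) + tr(QRS) + tr(QRSᵀ) + tr(QRᵀS) + tr(QRᵀSᵀ) + tr(QSR) + tr(QSRᵀ) + tr(QSᵀR) + tr(QSᵀRᵀ). -/

import Mathlib

open MeasureTheory ProbabilityTheory Matrix

noncomputable def stdGaussian (p : ℕ) : Measure (Fin p → ℝ) :=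
  Measure.pi fun _ => gaussianReal 0 1

lemma integrable_pow_gaussianReal (m : ℝ) (v : NNReal) (n : ℕ) :
    Integrable (fun x : ℝ => x ^ n) (gaussianReal m v) := by
  have h := (memLp_id_gaussianReal' (μ := m) (v := v) n (by simp)).integrable_norm_pow'
  exact h.mono (by fun_prop) (by simp)

/-- Moment recursion for the standard Gaussian distribution on `ℝ`. -/
lemma integral_pow_succ_gaussianReal (n : ℕ) :
    ∫ x, x ^ (n + 1) ∂(gaussianReal 0 1) = n * ∫ x, x ^ (n - 1) ∂(gaussianReal 0 1) := by
  have hd : ∀ x, HasDerivAt (fun x => -gaussianPDFReal 0 1 x) (x * gaussianPDFReal 0 1 x) x := by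
    intro x
    have h := (((hasDerivAt_pow 2 x).neg.div_const 2).exp.const_mul (√(2 * Real.pi))⁻¹).neg
    convert! h using 1
    · ext y; simp [gaussianPDFReal]
    · simp [gaussianPDFReal]; ring
  have hi : ∀ k : ℕ, Integrable (fun x : ℝ => x ^ k * gaussianPDFReal 0 1 x) := by
    intro k
    have h := integrable_pow_gaussianReal 0 1 k
    rw [gaussianReal_of_var_ne_zero _ one_ne_zero,
      integrable_withDensity_iff (measurable_gaussianPDF 0 1) (by simp [gaussianPDF_lt_top])] at h
    simpa using h
  have h := integral_mul_deriv_eq_deriv_mul_of_integrable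
    (fun x _ => hasDerivAt_pow n x) (fun x _ => hd x)
    (by convert! hi (n + 1) using 1; ext x; simp; ring)
    (by convert! (hi (n - 1)).const_mul (-(n : ℝ)) using 1; ext x; simp; ring)
    (by convert! (hi n).neg using 1; ext x; simp)
  rw [integral_gaussianReal_eq_integral_smul one_ne_zero,
    integral_gaussianReal_eq_integral_smul one_ne_zero, ← integral_const_mul]
  simp only [mul_neg, integral_neg, neg_neg] at h
  convert! h using 3 <;> simp <;> ring

section GaussianPolynomial

open MvPolynomial

variable {p : ℕ}

lemma eval_monomial_eq_mul_prod (s : Fin p →₀ ℕ) (a : ℝ) (x : Fin p → ℝ) :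
    eval x (monomial s a) = a * ∏ j, x j ^ s j := by
  rw [eval_monomial, Finsupp.prod_fintype _ _ (by simp)]

lemma integrable_eval_stdGaussian (P : MvPolynomial (Fin p) ℝ) :
    Integrable (fun x => eval x P) (stdGaussian p) := by
  induction P using MvPolynomial.induction_on' with
  | monomial s a =>
    simp only [eval_monomial_eq_mul_prod]
    exact (Integrable.fintype_prod (f := fun j (y : ℝ) => y ^ s j)
      fun j => integrable_pow_gaussianReal 0 1 (s j)).const_mul a
  | add P P' hP hP' =>
    simp only [map_add]
    exact hP.add hP'

/-- Expectation of a polynomial in independent standard normal variables. -/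
noncomputable def gaussianExpectation (p : ℕ) : MvPolynomial (Fin p) ℝ →ₗ[ℝ] ℝ where
  toFun P := ∫ x, eval x P ∂(stdGaussian p)
  map_add' P P' := by
    simpa using integral_add (integrable_eval_stdGaussian P) (integrable_eval_stdGaussian P')
  map_smul' c P := by simp [integral_const_mul]

lemma gaussianExpectation_monomial (s : Fin p →₀ ℕ) (a : ℝ) :
    gaussianExpectation p (monomial s a) = a * ∏ j, ∫ y, y ^ s j ∂(gaussianReal 0 1) := by
  change ∫ x, eval x (monomial s a) ∂(stdGaussian p) = _
  simp only [eval_monomial_eq_mul_prod, integral_const_mul, _root_.stdGaussian]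
  rw [integral_fintype_prod_eq_prod (fun j (y : ℝ) => y ^ s j)]

lemma gaussianExpectation_one : gaussianExpectation p 1 = 1 := by
  have h := gaussianExpectation_monomial (p := p) 0 1
  simpa using h

/-- Gaussian integration by parts for polynomials. -/
lemma gaussianExpectation_X_mul (i : Fin p) (P : MvPolynomial (Fin p) ℝ) :
    gaussianExpectation p (X i * P) = gaussianExpectation p (pderiv i P) := by
  induction P using MvPolynomial.induction_on' with
  | monomial s a =>
    rw [X, monomial_mul, pderiv_monomial, gaussianExpectation_monomial,
      gaussianExpectation_monomial, ← Finset.mul_prod_erase _ _ (Finset.mem_univ i),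
      ← Finset.mul_prod_erase _ _ (Finset.mem_univ i)]
    have h : ∀ j ∈ Finset.univ.erase i,
        (Finsupp.single i 1 + s : Fin p →₀ ℕ) j = (s - Finsupp.single i 1 : Fin p →₀ ℕ) j := by
      intro j hj
      simp [Finsupp.single_eq_of_ne (Finset.ne_of_mem_erase hj)]
    rw [Finset.prod_congr rfl fun j hj => by rw [h j hj]]
    simp only [Finsupp.add_apply, Finsupp.tsub_apply, Finsupp.single_eq_same]
    rw [add_comm 1 (s i), integral_pow_succ_gaussianReal]
    ring
  | add P P' hP hP' => simp only [mul_add, map_add, hP, hP']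

/-- The vector of linear forms `A x`, as polynomials in the coordinates of `x`. -/
noncomputable def linearForms (A : Matrix (Fin p) (Fin p) ℝ) : Fin p → MvPolynomial (Fin p) ℝ :=
  A.map C *ᵥ X

/-- The quadratic form `x ⬝ᵥ A *ᵥ x`, as a polynomial in the coordinates of `x`. -/
noncomputable def quadraticPolynomial (A : Matrix (Fin p) (Fin p) ℝ) : MvPolynomial (Fin p) ℝ :=
  X ⬝ᵥ linearForms A

lemma eval_quadraticPolynomial (A : Matrix (Fin p) (Fin p) ℝ) (x : Fin p → ℝ) :
    eval x (quadraticPolynomial A) = x ⬝ᵥ A *ᵥ x := by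
  simp [quadraticPolynomial, linearForms, dotProduct, mulVec]

lemma pderiv_linearForms (A : Matrix (Fin p) (Fin p) ℝ) (i j : Fin p) :
    pderiv i (linearForms A j) = C (A j i) := by
  simp [linearForms, dotProduct, mulVec, pderiv_X, Pi.single_apply, Derivation.leibniz]

lemma pderiv_quadraticPolynomial (A : Matrix (Fin p) (Fin p) ℝ) (i : Fin p) :
    pderiv i (quadraticPolynomial A) = linearForms (A + Aᵀ) i := by
  simp only [quadraticPolynomial, dotProduct, map_sum, Derivation.leibniz, pderiv_linearForms,
    smul_eq_mul, pderiv_X, Pi.single_apply]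
  simp only [linearForms, mulVec, dotProduct, Matrix.map_apply, Matrix.add_apply,
    transpose_apply, map_add, add_mul, Finset.sum_add_distrib]
  simp [mul_comm, add_comm]

lemma linearForms_dotProduct_linearForms (A B : Matrix (Fin p) (Fin p) ℝ) :
    linearForms A ⬝ᵥ linearForms B = quadraticPolynomial (Aᵀ * B) := by
  rw [quadraticPolynomial, linearForms, linearForms, linearForms, Matrix.map_mul, ← mulVec_mulVec,
    dotProduct_mulVec X, transpose_map, vecMul_transpose]

lemma gaussianExpectation_quadraticPolynomial_mul (A : Matrix (Fin p) (Fin p) ℝ)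
    (P : MvPolynomial (Fin p) ℝ) :
    gaussianExpectation p (quadraticPolynomial A * P) = A.trace * gaussianExpectation p P
      + gaussianExpectation p (linearForms A ⬝ᵥ fun i => pderiv i P) := by
  simp only [quadraticPolynomial, dotProduct, Finset.sum_mul, map_sum, mul_assoc,
    gaussianExpectation_X_mul, Derivation.leibniz, pderiv_linearForms, smul_eq_mul, map_add,
    Finset.sum_add_distrib, mul_comm _ (C _), ← smul_eq_C_mul, map_smul, trace, diag_apply]
  ring

lemma gaussianExpectation_quadraticPolynomial (A : Matrix (Fin p) (Fin p) ℝ) :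
    gaussianExpectation p (quadraticPolynomial A) = A.trace := by
  have h := gaussianExpectation_quadraticPolynomial_mul A 1
  simpa [gaussianExpectation_one, dotProduct] using h

lemma gaussianExpectation_quadraticPolynomial_mul_quadraticPolynomial
    (A B : Matrix (Fin p) (Fin p) ℝ) :
    gaussianExpectation p (quadraticPolynomial A * quadraticPolynomial B) =
      A.trace * B.trace + (A * B).trace + (A * Bᵀ).trace := by
  simp only [gaussianExpectation_quadraticPolynomial_mul, pderiv_quadraticPolynomial,
    linearForms_dotProduct_linearForms, gaussianExpectation_quadraticPolynomial]
  rw [mul_add, trace_add, ← trace_transpose (Aᵀ * B), ← trace_transpose (Aᵀ * Bᵀ)]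
  simp only [transpose_mul, transpose_transpose, trace_mul_comm _ A]
  ring

lemma gaussianExpectation_mul_three (Q R S : Matrix (Fin p) (Fin p) ℝ) :
    gaussianExpectation p
        (quadraticPolynomial Q * (quadraticPolynomial R * quadraticPolynomial S)) =
      Q.trace * gaussianExpectation p (quadraticPolynomial R * quadraticPolynomial S)
        + gaussianExpectation p (quadraticPolynomial (Qᵀ * (R + Rᵀ)) * quadraticPolynomial S)
        + gaussianExpectation p (quadraticPolynomial (Qᵀ * (S + Sᵀ)) * quadraticPolynomial R) := by
  rw [gaussianExpectation_quadraticPolynomial_mul, add_assoc, ← map_add,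
    ← linearForms_dotProduct_linearForms, ← linearForms_dotProduct_linearForms]
  congr 2
  simp only [Derivation.leibniz, pderiv_quadraticPolynomial, smul_eq_mul, dotProduct,
    Finset.sum_mul, ← Finset.sum_add_distrib]
  exact Finset.sum_congr rfl fun i _ => by ring

end GaussianPolynomial

/-- Expectation of the product of three Gaussian quadratic forms. -/
theorem product_three_quadratic_forms (p : ℕ)
    (Q R S : Matrix (Fin p) (Fin p) ℝ) :
    ∫ x, (x ⬝ᵥ Q.mulVec x) * (x ⬝ᵥ R.mulVec x) * (x ⬝ᵥ S.mulVec x)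
        ∂(stdGaussian p)
      = Q.trace * R.trace * S.trace
        + Q.trace * (R * S).trace + Q.trace * (R * Sᵀ).trace
        + R.trace * (Q * S).trace + R.trace * (Q * Sᵀ).trace
        + S.trace * (Q * R).trace + S.trace * (Q * Rᵀ).trace
        + (Q * R * S).trace + (Q * R * Sᵀ).trace
        + (Q * Rᵀ * S).trace + (Q * Rᵀ * Sᵀ).trace
        + (Q * S * R).trace + (Q * S * Rᵀ).trace
        + (Q * Sᵀ * R).trace + (Q * Sᵀ * Rᵀ).trace := by
  have h : ∀ x, (x ⬝ᵥ Q.mulVec x) * (x ⬝ᵥ R.mulVec x) * (x ⬝ᵥ S.mulVec x) =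
      MvPolynomial.eval x
        (quadraticPolynomial Q * (quadraticPolynomial R * quadraticPolynomial S)) := by
    intro x
    simp only [map_mul, eval_quadraticPolynomial, mul_assoc]
  simp only [h]
  change gaussianExpectation p _ = _
  rw [gaussianExpectation_mul_three]
  simp only [gaussianExpectation_quadraticPolynomial_mul_quadraticPolynomial]
  have transpose_three (A B D : Matrix (Fin p) (Fin p) ℝ) :
      (Aᵀ * B * D).trace = (A * Dᵀ * Bᵀ).trace := by
    rw [← trace_transpose, transpose_mul, transpose_mul, transpose_transpose, ← mul_assoc,
      trace_mul_comm, ← mul_assoc]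
  have transpose_two (A B : Matrix (Fin p) (Fin p) ℝ) :
      (Aᵀ * B).trace = (A * Bᵀ).trace := by
    rw [← trace_transpose, transpose_mul, transpose_transpose, trace_mul_comm]
  simp only [mul_add, add_mul, trace_add, transpose_three, transpose_two, transpose_transpose]
  ring
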